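/- Let 0 < T ≤ ∞, δ ∈ (0,1), A, B ≥ 0, and let f : [0,T) → [0,∞) be continuous and satisfy f(t) ≤ A + B ∫₀^t (t-s)^{-δ} f(s) ds for all t ∈ [0,T). Then f(t) ≤ A Φ(B Γ(1-δ) t^{1-δ}) for all t ∈ [0,T), where Φ(z) = Σ_{n=0}^∞ z^n / Γ(n(1-δ)+1) and Γ is the Gamma function. -/

import Mathlib

open MeasureTheory ENNReal

/-- Lower bound for the Gamma function. -/
lemma gw_gamma_lower {x R : ℝ} (hx : 1 ≤ x) (hR : 0 < R) :
    R ^ (x - 1) * Real.exp (-R) ≤ Real.Gamma x := by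
  have hx0 : 0 < x := by linarith
  rw [Real.Gamma_eq_integral hx0, ← integral_exp_neg_Ioi R, ← integral_const_mul]
  have hsub : Set.Ioi R ⊆ Set.Ioi (0 : ℝ) := Set.Ioi_subset_Ioi hR.le
  calc ∫ s in Set.Ioi R, R ^ (x - 1) * Real.exp (-s)
      ≤ ∫ s in Set.Ioi R, Real.exp (-s) * s ^ (x - 1) := by
        apply setIntegral_mono_on
        · exact (integrableOn_exp_neg_Ioi R).const_mul _
        · exact (Real.GammaIntegral_convergent hx0).mono_set hsub
        · exact measurableSet_Ioi
        · intro s hs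
          rw [mul_comm]
          have : R ≤ s := le_of_lt hs
          gcongr
    _ ≤ _ := by
        apply setIntegral_mono_set (Real.GammaIntegral_convergent hx0)
        · refine (ae_restrict_iff' measurableSet_Ioi).2 (Filter.Eventually.of_forall ?_)
          intro s hs
          have : (0 : ℝ) < s := hs
          simp only [Pi.zero_apply]
          positivity
        · exact hsub.eventuallyLE

lemma gw_summable {a z : ℝ} (ha : 0 < a) (hz : 0 ≤ z) :
    Summable (fun n : ℕ => z ^ n / Real.Gamma ((n : ℝ) * a + 1)) := by
  set R : ℝ := (2 * z + 1) ^ (a⁻¹) with hRdef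
  have hq : 0 < 2 * z + 1 := by positivity
  have hR : 0 < R := Real.rpow_pos_of_pos hq _
  have hRa : R ^ a = 2 * z + 1 := by
    rw [hRdef, ← Real.rpow_mul hq.le, inv_mul_cancel₀ ha.ne', Real.rpow_one]
  have hlt : z / (2 * z + 1) < 1 := by rw [div_lt_one hq]; linarith
  refine Summable.of_nonneg_of_le (f := fun n : ℕ => Real.exp R * (z / (2 * z + 1)) ^ n) ?_ ?_ ?_
  · intro n
    have := Real.Gamma_pos_of_pos (show 0 < (n : ℝ) * a + 1 by positivity)
    positivity
  · intro n
    have h1 : (1 : ℝ) ≤ (n : ℝ) * a + 1 := by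
      have : 0 ≤ (n : ℝ) * a := by positivity
      linarith
    have h := gw_gamma_lower h1 hR
    have h2 : R ^ ((n : ℝ) * a + 1 - 1) = (2 * z + 1) ^ n := by
      rw [add_sub_cancel_right, mul_comm, Real.rpow_mul hR.le, hRa, Real.rpow_natCast]
    rw [h2] at h
    calc z ^ n / Real.Gamma ((n : ℝ) * a + 1) ≤ z ^ n / ((2 * z + 1) ^ n * Real.exp (-R)) := by
          gcongr
      _ = _ := by
          rw [Real.exp_neg, div_pow]; field_simp
  · exact (summable_geometric_of_lt_one (by positivity) hlt).mul_left _

/-- Real scaled beta integral. -/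
lemma gw_beta {u v t : ℝ} (hu : 0 < u) (hv : 0 < v) (ht : 0 < t) :
    ∫ s in (0 : ℝ)..t, s ^ (u - 1) * (t - s) ^ (v - 1) =
      t ^ (u + v - 1) * (Real.Gamma u * Real.Gamma v / Real.Gamma (u + v)) := by
  have h := Complex.betaIntegral_scaled (u : ℂ) (v : ℂ) ht
  rw [Complex.betaIntegral_eq_Gamma_mul_div _ _ (by simpa) (by simpa)] at h
  apply Complex.ofReal_injective
  rw [← intervalIntegral.integral_ofReal]
  push_cast
  rw [Complex.ofReal_cpow ht.le, ← Complex.Gamma_ofReal, ← Complex.Gamma_ofReal,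
    ← Complex.Gamma_ofReal]
  push_cast
  rw [← h]
  apply intervalIntegral.integral_congr
  intro s hs
  rw [Set.uIcc_of_le ht.le] at hs
  have h0 : 0 ≤ t - s := by linarith [hs.2]
  simp only []
  rw [Complex.ofReal_cpow hs.1, Complex.ofReal_cpow h0]
  push_cast
  rfl

/-- The terms of the Mittag-Leffler series. -/
noncomputable def gwE (a B : ℝ) (n : ℕ) (t : ℝ) : ℝ :=
  (B * Real.Gamma a * t ^ a) ^ n / Real.Gamma ((n : ℝ) * a + 1)

lemma gwE_cont {a B : ℝ} (ha : 0 < a) (n : ℕ) : Continuous (gwE a B n) := by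
  unfold gwE
  have : Continuous fun t : ℝ => t ^ a := Real.continuous_rpow_const ha.le
  fun_prop

lemma gwE_step {a B t : ℝ} (ha : 0 < a) (ht : 0 ≤ t) (n : ℕ) :
    B * ∫ s in (0 : ℝ)..t, (t - s) ^ (a - 1) * gwE a B n s = gwE a B (n + 1) t := by
  rcases ht.eq_or_lt with rfl | ht
  · simp [gwE, Real.zero_rpow ha.ne']
  have hna : 0 < (n : ℝ) * a + 1 := by positivity
  have hG := (Real.Gamma_pos_of_pos hna).ne'
  have hcongr : ∫ s in (0 : ℝ)..t, (t - s) ^ (a - 1) * gwE a B n s =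
      ∫ s in (0 : ℝ)..t, ((B * Real.Gamma a) ^ n / Real.Gamma ((n : ℝ) * a + 1)) *
        (s ^ (((n : ℝ) * a + 1) - 1) * (t - s) ^ (a - 1)) := by
    apply intervalIntegral.integral_congr
    intro s hs
    rw [Set.uIcc_of_le ht.le] at hs
    simp only [gwE]
    rw [add_sub_cancel_right, mul_comm (n : ℝ) a, Real.rpow_mul hs.1, Real.rpow_natCast, mul_pow]
    ring
  rw [hcongr, intervalIntegral.integral_const_mul, gw_beta hna ha ht, gwE]
  have e1 : (n : ℝ) * a + 1 + a - 1 = a * ((n + 1 : ℕ) : ℝ) := by push_cast; ring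
  have e2 : (n : ℝ) * a + 1 + a = ((n + 1 : ℕ) : ℝ) * a + 1 := by push_cast; ring
  rw [e1, e2, Real.rpow_mul ht.le, Real.rpow_natCast]
  field_simp
  ring

lemma gw_kernel {a t : ℝ} (ha : 0 < a) (ht : 0 ≤ t) {g : ℝ → ℝ}
    (hg : ContinuousOn g (Set.Icc 0 t)) :
    IntervalIntegrable (fun s => (t - s) ^ (a - 1) * g s) volume 0 t := by
  apply IntervalIntegrable.mul_continuousOn
  · have h := (intervalIntegral.intervalIntegrable_rpow' (a := 0) (b := t)
      (show -1 < a - 1 by linarith)).comp_sub_left t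
    simpa using h.symm
  · rwa [Set.uIcc_of_le ht]

lemma gw_iter {a A B M t₀ : ℝ} (ha : 0 < a) (hB : 0 ≤ B) {f : ℝ → ℝ}
    (hc : ContinuousOn f (Set.Icc 0 t₀)) (hM : ∀ t ∈ Set.Icc 0 t₀, f t ≤ M)
    (hi : ∀ t ∈ Set.Icc 0 t₀, f t ≤ A + B * ∫ s in (0 : ℝ)..t, (t - s) ^ (a - 1) * f s)
    (n : ℕ) : ∀ t ∈ Set.Icc 0 t₀,
      f t ≤ A * ∑ k ∈ Finset.range n, gwE a B k t + M * gwE a B n t := by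
  induction n with
  | zero => intro t ht; simpa [gwE] using hM t ht
  | succ n ih =>
    intro t ht
    have hsub : Set.Icc 0 t ⊆ Set.Icc 0 t₀ := Set.Icc_subset_Icc_right ht.2
    have hk : ∀ k, IntervalIntegrable (fun s => (t - s) ^ (a - 1) * gwE a B k s) volume 0 t :=
      fun k => gw_kernel ha ht.1 (gwE_cont ha k).continuousOn
    have hS : IntervalIntegrable (fun s => ∑ k ∈ Finset.range n, (t - s) ^ (a - 1) * gwE a B k s)
        volume 0 t := by
      simp only [← Finset.mul_sum]
      exact gw_kernel ha ht.1
        (continuous_finsetSum _ fun k _ => gwE_cont ha k).continuousOn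
    have hmono : ∫ s in (0 : ℝ)..t, (t - s) ^ (a - 1) * f s ≤
        ∫ s in (0 : ℝ)..t, (A * ∑ k ∈ Finset.range n, (t - s) ^ (a - 1) * gwE a B k s +
          M * ((t - s) ^ (a - 1) * gwE a B n s)) := by
      apply intervalIntegral.integral_mono_on ht.1 (gw_kernel ha ht.1 (hc.mono hsub))
        ((hS.const_mul A).add ((hk n).const_mul M))
      intro s hs
      have h0 : 0 ≤ t - s := by linarith [hs.2]
      have := mul_le_mul_of_nonneg_left (ih s (hsub hs)) (Real.rpow_nonneg h0 (a - 1))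
      rw [← Finset.mul_sum]
      linarith
    rw [intervalIntegral.integral_add (hS.const_mul A) ((hk n).const_mul M),
      intervalIntegral.integral_const_mul, intervalIntegral.integral_const_mul,
      intervalIntegral.integral_finsetSum (fun k _ => hk k)] at hmono
    have h1 := hi t ht
    have h2 := mul_le_mul_of_nonneg_left hmono hB
    have h3 : B * ∑ k ∈ Finset.range n, ∫ s in (0 : ℝ)..t, (t - s) ^ (a - 1) * gwE a B k s =
        ∑ k ∈ Finset.range n, gwE a B (k + 1) t := by
      rw [Finset.mul_sum]
      exact Finset.sum_congr rfl fun k _ => gwE_step ha ht.1 k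
    have h4 := gwE_step (B := B) ha ht.1 n
    rw [Finset.sum_range_succ', ← h3, ← h4]
    have h5 : gwE a B 0 t = 1 := by simp [gwE]
    rw [h5]
    linarith

/-- Modified Gronwall lemma (Lemma 2.7 of the paper): if `f : [0,T) → [0,∞)` is continuous
and satisfies `f t ≤ A + B ∫₀ᵗ (t-s)^{-δ} f s ds`, then
`f t ≤ A * Φ(B Γ(1-δ) t^{1-δ})` where `Φ z = ∑ zⁿ / Γ(n(1-δ)+1)`. -/
theorem stmt1 (T : ℝ≥0∞) (hT : 0 < T) (δ A B : ℝ) (hδ : δ ∈ Set.Ioo (0 : ℝ) 1)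
    (hA : 0 ≤ A) (hB : 0 ≤ B) (f : ℝ → ℝ)
    (hf_nonneg : ∀ t : ℝ, 0 ≤ t → ENNReal.ofReal t < T → 0 ≤ f t)
    (hf_cont : ContinuousOn f {t : ℝ | 0 ≤ t ∧ ENNReal.ofReal t < T})
    (hineq : ∀ t : ℝ, 0 ≤ t → ENNReal.ofReal t < T →
      f t ≤ A + B * ∫ s in Set.Ioc (0 : ℝ) t, (t - s) ^ (-δ) * f s) :
    ∀ t : ℝ, 0 ≤ t → ENNReal.ofReal t < T →
      f t ≤ A * ∑' n : ℕ,
        (B * Real.Gamma (1 - δ) * t ^ (1 - δ)) ^ n / Real.Gamma ((n : ℝ) * (1 - δ) + 1) := by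
  intro t ht htT
  have ha : 0 < 1 - δ := by linarith [hδ.2]
  have hlt : ∀ s ∈ Set.Icc 0 t, ENNReal.ofReal s < T := fun s hs =>
    (ENNReal.ofReal_le_ofReal hs.2).trans_lt htT
  have hc : ContinuousOn f (Set.Icc 0 t) := hf_cont.mono fun s hs => ⟨hs.1, hlt s hs⟩
  obtain ⟨M, hM⟩ := (isCompact_Icc.image_of_continuousOn hc).bddAbove
  have hM' : ∀ s ∈ Set.Icc 0 t, f s ≤ M := fun s hs => hM ⟨s, hs, rfl⟩
  have hi : ∀ s ∈ Set.Icc 0 t,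
      f s ≤ A + B * ∫ r in (0 : ℝ)..s, (s - r) ^ ((1 - δ) - 1) * f r := by
    intro s hs
    have h := hineq s hs.1 (hlt s hs)
    rw [intervalIntegral.integral_of_le hs.1]
    have e : 1 - δ - 1 = -δ := by ring
    rwa [e]
  have hG := Real.Gamma_pos_of_pos ha
  have hs : Summable (fun n => gwE (1 - δ) B n t) :=
    gw_summable ha (show 0 ≤ B * Real.Gamma (1 - δ) * t ^ (1 - δ) by positivity)
  have hlim := (hs.hasSum.tendsto_sum_nat.const_mul A).add
    (hs.tendsto_atTop_zero.const_mul M)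
  have := ge_of_tendsto' hlim fun n => gw_iter ha hB hc hM' hi n t ⟨ht, le_rfl⟩
  rw [mul_zero, add_zero] at this
  exact this
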